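/- Let E be a complex Banach space having martingale type 2 with constant M ∈ (0,∞). Then there exists C = C(M) ∈ (0,∞) such that for every n ∈ ℕ and every function f : 𝒞_n → E, one has ‖f − E_{σ_n} f‖_{L_2(σ_n;E)}^2 ≤ C ∑_{i=1}^n ‖∂_i f‖_{L_2(σ_n;E)}^2 / (1 + log(‖∂_i f‖_{L_2(σ_n;E)} / ‖∂_i f‖_{L_1(σ_n;E)})), with the convention that the i-th summand is 0 when ∂_i f vanishes identically. -/

import Mathlib

open Finset MeasureTheory Real Filter

noncomputable section

/-- The discrete hypercube `𝒞_n = {-1,1}^n`, encoded as `Fin n → Bool`. -/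
abbrev Cube (n : ℕ) := Fin n → Bool

/-- The sign `±1` associated to a boolean coordinate. -/
def sgn' (b : Bool) : ℝ := if b then 1 else -1

/-- Flip the `i`-th coordinate of a point of the hypercube. -/
def flipC {n : ℕ} (i : Fin n) (x : Cube n) : Cube n := Function.update x i (!(x i))

variable {E : Type*} [NormedAddCommGroup E]

/-- Expectation `E_{σ_n} f` with respect to the uniform probability measure on the cube. -/
def cubeAvg {n : ℕ} [NormedSpace ℝ E] (f : Cube n → E) : E :=
  (2 ^ n : ℝ)⁻¹ • ∑ x : Cube n, f x

/-- The discrete partial derivative `∂_i f (ε) = (f(ε) - f(ε with i-th coordinate flipped))/2`. -/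
def dparC {n : ℕ} [NormedSpace ℝ E] (i : Fin n) (f : Cube n → E) : Cube n → E :=
  fun x => (2 : ℝ)⁻¹ • (f x - f (flipC i x))

/-- The `L_p(σ_n; E)` norm of a function on the hypercube. -/
def cubeLp {n : ℕ} (p : ℝ) (f : Cube n → E) : ℝ :=
  ((2 ^ n : ℝ)⁻¹ * ∑ x : Cube n, ‖f x‖ ^ p) ^ (1 / p)

lemma two_mul_le_rpow_sub_rpow {q v : ℝ} (hq0 : 0 ≤ q) (hq1 : q ≤ 1) (hv0 : 0 ≤ v) (hv1 : v < 1) :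
    2 * q * v ≤ (1 + v) ^ q - (1 - v) ^ q := by
  have hd : ∀ u ∈ Set.Ico (0 : ℝ) 1, HasDerivAt
      (fun u : ℝ => (1 + u) ^ q - (1 - u) ^ q - 2 * q * u)
      (1 * q * (1 + u) ^ (q - 1) - (-1) * q * (1 - u) ^ (q - 1) - 2 * q * 1) u := by
    intro u hu
    have h1 : HasDerivAt (fun u : ℝ => 1 + u) 1 u := (hasDerivAt_id u).const_add 1
    have h2 : HasDerivAt (fun u : ℝ => 1 - u) (-1) u := (hasDerivAt_id u).const_sub 1
    refine ((h1.rpow_const (Or.inl ?_)).sub (h2.rpow_const (Or.inl ?_))).sub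
      ((hasDerivAt_id u).const_mul (2 * q)) <;> linarith [hu.1, hu.2]
  have hmono : MonotoneOn (fun u : ℝ => (1 + u) ^ q - (1 - u) ^ q - 2 * q * u)
      (Set.Ico 0 1) := by
    refine monotoneOn_of_deriv_nonneg (convex_Ico 0 1)
      (fun u hu => (hd u hu).continuousAt.continuousWithinAt)
      (fun u hu => (hd u (interior_subset hu)).differentiableAt.differentiableWithinAt) ?_
    intro u hu
    obtain ⟨hu0, hu1⟩ := interior_subset hu
    rw [(hd u ⟨hu0, hu1⟩).deriv]
    have ha : 0 < (1 + u) ^ (q - 1) := Real.rpow_pos_of_pos (by linarith) _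
    have hb : 0 < (1 - u) ^ (q - 1) := Real.rpow_pos_of_pos (by linarith) _
    have hab : 1 ≤ (1 + u) ^ (q - 1) * (1 - u) ^ (q - 1) := by
      rw [← Real.mul_rpow (by linarith) (by linarith)]
      exact Real.one_le_rpow_of_pos_of_le_one_of_nonpos (by nlinarith) (by nlinarith) (by linarith)
    have hsum : 2 ≤ (1 + u) ^ (q - 1) + (1 - u) ^ (q - 1) := by
      nlinarith [sq_nonneg ((1 + u) ^ (q - 1) - (1 - u) ^ (q - 1))]
    nlinarith
  have := hmono (Set.left_mem_Ico.2 one_pos) ⟨hv0, hv1⟩ hv0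
  simp only [add_zero, sub_zero, mul_zero, Real.one_rpow, sub_self] at this
  linarith

/-- Second-order lower bound for the symmetrised power function. -/
lemma one_add_sq_le_rpow_add_rpow {p v : ℝ} (hp1 : 1 ≤ p) (hp2 : p ≤ 2) (hv0 : 0 ≤ v)
    (hv1 : v ≤ 1) :
    1 + p * (p - 1) / 2 * v ^ 2 ≤ ((1 + v) ^ p + (1 - v) ^ p) / 2 := by
  have hd : ∀ u : ℝ, HasDerivAt
      (fun u : ℝ => (1 + u) ^ p + (1 - u) ^ p - p * (p - 1) * u ^ 2)
      (1 * p * (1 + u) ^ (p - 1) + (-1) * p * (1 - u) ^ (p - 1)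
        - p * (p - 1) * (2 * u)) u := by
    intro u
    have h1 : HasDerivAt (fun u : ℝ => 1 + u) 1 u := (hasDerivAt_id u).const_add 1
    have h2 : HasDerivAt (fun u : ℝ => 1 - u) (-1) u := (hasDerivAt_id u).const_sub 1
    have h3 : HasDerivAt (fun u : ℝ => u ^ 2) (2 * u) u := by simpa using hasDerivAt_pow 2 u
    exact ((h1.rpow_const (Or.inr hp1)).add (h2.rpow_const (Or.inr hp1))).sub (h3.const_mul _)
  have hmono : MonotoneOn (fun u : ℝ => (1 + u) ^ p + (1 - u) ^ p - p * (p - 1) * u ^ 2)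
      (Set.Icc 0 1) := by
    refine monotoneOn_of_deriv_nonneg (convex_Icc 0 1)
      (fun u _ => (hd u).continuousAt.continuousWithinAt)
      (fun u _ => (hd u).differentiableAt.differentiableWithinAt) ?_
    intro u hu
    rw [interior_Icc] at hu
    rw [(hd u).deriv]
    have := two_mul_le_rpow_sub_rpow (q := p - 1) (by linarith) (by linarith) hu.1.le hu.2
    nlinarith
  have := hmono (Set.left_mem_Icc.2 zero_le_one) ⟨hv0, hv1⟩ hv0
  simp only [add_zero, sub_zero, Real.one_rpow] at this
  norm_num at this
  linarith

/-- The two-point hypercontractive inequality from `L_p` to `L_2`, for nonnegative functions. -/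
lemma two_point_hypercontractive {p r x y : ℝ} (hp1 : 1 ≤ p) (hp2 : p ≤ 2) (hr : r ^ 2 ≤ p - 1)
    (hx : 0 ≤ x) (hy : 0 ≤ y) :
    ((x + y) / 2) ^ 2 + r ^ 2 * ((x - y) / 2) ^ 2 ≤ ((x ^ p + y ^ p) / 2) ^ (2 / p) := by
  wlog hxy : y ≤ x generalizing x y
  · have := this hy hx (le_of_not_ge hxy)
    rw [add_comm x y, add_comm (x ^ p), show ((x - y) / 2) ^ 2 = ((y - x) / 2) ^ 2 by ring]
    exact this
  rcases hx.eq_or_lt with rfl | hx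
  · obtain rfl : y = 0 := le_antisymm hxy hy
    simp only [add_zero, zero_div, sub_self]
    norm_num
    positivity
  have hp0 : 0 < p := by linarith
  set u := (x + y) / 2 with hu
  have hu0 : 0 < u := by positivity
  set v := (x - y) / 2 / u with hv
  have hvu : (x - y) / 2 = u * v := by rw [hv]; field_simp
  have hv0 : 0 ≤ v := div_nonneg (by linarith) hu0.le
  have hv1 : v ≤ 1 := by rw [hv, div_le_one hu0]; linarith
  have hx' : x = u * (1 + v) := by linarith
  have hy' : y = u * (1 - v) := by linarith
  have hb : 1 + (p - 1) * v ^ 2 ≤ (((1 + v) ^ p + (1 - v) ^ p) / 2) ^ (2 / p) := by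
    have h1 : (1 + (p - 1) * v ^ 2) ^ (p / 2) ≤ ((1 + v) ^ p + (1 - v) ^ p) / 2 := by
      refine le_trans ?_ (one_add_sq_le_rpow_add_rpow hp1 hp2 hv0 hv1)
      have := rpow_one_add_le_one_add_mul_self (s := (p - 1) * v ^ 2)
        (by nlinarith [sq_nonneg v]) (p := p / 2) (by linarith) (by linarith)
      linarith
    have h0 : 0 ≤ 1 + (p - 1) * v ^ 2 := by nlinarith [sq_nonneg v]
    calc 1 + (p - 1) * v ^ 2 = ((1 + (p - 1) * v ^ 2) ^ (p / 2)) ^ (2 / p) := by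
          rw [← Real.rpow_mul h0, show p / 2 * (2 / p) = 1 by field_simp, Real.rpow_one]
      _ ≤ _ := Real.rpow_le_rpow (by positivity) h1 (by positivity)
  have hR : ((x ^ p + y ^ p) / 2) ^ (2 / p)
      = u ^ 2 * (((1 + v) ^ p + (1 - v) ^ p) / 2) ^ (2 / p) := by
    have h1v : 0 ≤ 1 - v := by linarith
    rw [hx', hy', Real.mul_rpow hu0.le (by linarith), Real.mul_rpow hu0.le h1v, ← mul_add,
      mul_div_assoc, Real.mul_rpow (by positivity) (by positivity), ← Real.rpow_mul hu0.le,
      show p * (2 / p) = (2 : ℕ) by field_simp; norm_num, Real.rpow_natCast]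
  rw [hR, hvu]
  calc u ^ 2 + r ^ 2 * (u * v) ^ 2 ≤ u ^ 2 * (1 + (p - 1) * v ^ 2) := by
        nlinarith [mul_le_mul_of_nonneg_right hr (sq_nonneg (u * v))]
    _ ≤ _ := by gcongr

/-- Minkowski's inequality in `L_{2/p}` for the uniform average of two functions. -/
lemma weighted_sum_rpow_half_add_le {ι : Type*} (s : Finset ι) {p c : ℝ} (hp1 : 1 ≤ p)
    (hp2 : p ≤ 2) (hc : 0 ≤ c) {f g : ι → ℝ} (hf : ∀ i, 0 ≤ f i) (hg : ∀ i, 0 ≤ g i) :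
    c * ∑ i ∈ s, ((f i ^ p + g i ^ p) / 2) ^ (2 / p)
      ≤ (((c * ∑ i ∈ s, f i ^ 2) ^ (p / 2) + (c * ∑ i ∈ s, g i ^ 2) ^ (p / 2)) / 2) ^ (2 / p) := by
  have hp0 : 0 < p := by linarith
  have hr : 1 ≤ 2 / p := by rw [le_div_iff₀ hp0]; linarith
  have hinv : 1 / (2 / p) = p / 2 := by field_simp
  have hpow : ∀ x : ℝ, 0 ≤ x → (x ^ p) ^ (2 / p) = x ^ 2 := by
    intro x hx
    rw [← Real.rpow_mul hx, show p * (2 / p) = (2 : ℕ) by field_simp; norm_num, Real.rpow_natCast]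
  have hM := Real.Lp_add_le_of_nonneg s hr (f := fun i => f i ^ p) (g := fun i => g i ^ p)
    (fun i _ => Real.rpow_nonneg (hf i) _) (fun i _ => Real.rpow_nonneg (hg i) _)
  simp only [hpow _ (hf _), hpow _ (hg _), hinv] at hM
  set S := ∑ i ∈ s, (f i ^ p + g i ^ p) ^ (2 / p) with hS
  have hS0 : 0 ≤ S := Finset.sum_nonneg fun i _ => by
    have := hf i; have := hg i; positivity
  have hA : 0 ≤ ∑ i ∈ s, f i ^ 2 := Finset.sum_nonneg fun i _ => sq_nonneg _
  have hB : 0 ≤ ∑ i ∈ s, g i ^ 2 := Finset.sum_nonneg fun i _ => sq_nonneg _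
  have hL : c * ∑ i ∈ s, ((f i ^ p + g i ^ p) / 2) ^ (2 / p)
      = (c ^ (p / 2) * S ^ (p / 2) / 2) ^ (2 / p) := by
    rw [← Real.mul_rpow hc hS0, Real.div_rpow (by positivity) (by norm_num),
      ← Real.rpow_mul (by positivity), show p / 2 * (2 / p) = 1 by field_simp, Real.rpow_one,
      hS, mul_div_assoc, Finset.sum_div]
    congr 1
    refine Finset.sum_congr rfl fun i _ => ?_
    have := hf i; have := hg i
    rw [Real.div_rpow (by positivity) (by norm_num)]
  rw [hL, Real.mul_rpow hc hA, Real.mul_rpow hc hB, ← mul_add]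
  gcongr

/-- Log-convexity of `L_p` norms between `L_1` and `L_2`. -/
lemma weighted_sum_rpow_le {ι : Type*} (s : Finset ι) {p c : ℝ} (hp1 : 1 ≤ p) (hp2 : p ≤ 2)
    {h : ι → ℝ} (hh : ∀ i, 0 ≤ h i) (hc : 0 ≤ c) (hA : 0 < c * ∑ i ∈ s, h i)
    (hB : 0 < c * ∑ i ∈ s, h i ^ 2) :
    c * ∑ i ∈ s, h i ^ p
      ≤ (c * ∑ i ∈ s, h i) ^ (2 - p) * (c * ∑ i ∈ s, h i ^ 2) ^ (p - 1) := by
  set A := c * ∑ i ∈ s, h i with hAdef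
  set B := c * ∑ i ∈ s, h i ^ 2 with hBdef
  have hpt : ∀ i ∈ s, h i ^ p
      ≤ A ^ (2 - p) * B ^ (p - 1) * ((2 - p) * (h i / A) + (p - 1) * (h i ^ 2 / B)) := by
    intro i _
    have hamgm := Real.geom_mean_le_arith_mean2_weighted (w₁ := 2 - p) (w₂ := p - 1)
      (p₁ := h i / A) (p₂ := h i ^ 2 / B) (by linarith) (by linarith)
      (div_nonneg (hh i) hA.le) (by positivity) (by ring)
    have hEq : h i ^ p
        = A ^ (2 - p) * B ^ (p - 1) * ((h i / A) ^ (2 - p) * (h i ^ 2 / B) ^ (p - 1)) := by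
      rw [Real.div_rpow (hh i) hA.le, Real.div_rpow (sq_nonneg _) hB.le]
      have h1 : A ^ (2 - p) ≠ 0 := (Real.rpow_pos_of_pos hA _).ne'
      have h2 : B ^ (p - 1) ≠ 0 := (Real.rpow_pos_of_pos hB _).ne'
      rw [show A ^ (2 - p) * B ^ (p - 1) * (h i ^ (2 - p) / A ^ (2 - p) *
        ((h i ^ 2) ^ (p - 1) / B ^ (p - 1))) = h i ^ (2 - p) * (h i ^ 2) ^ (p - 1) by field_simp,
        ← Real.rpow_natCast, ← Real.rpow_mul (hh i),
        ← Real.rpow_add_of_nonneg (hh i) (by linarith) (by push_cast; linarith)]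
      congr 1
      push_cast
      ring
    rw [hEq]
    gcongr
  calc c * ∑ i ∈ s, h i ^ p
      ≤ c * ∑ i ∈ s, A ^ (2 - p) * B ^ (p - 1) *
          ((2 - p) * (h i / A) + (p - 1) * (h i ^ 2 / B)) := by
        gcongr with i hi
        exact hpt i hi
    _ = A ^ (2 - p) * B ^ (p - 1) * ((2 - p) * (A / A) + (p - 1) * (B / B)) := by
        rw [← Finset.mul_sum, Finset.sum_add_distrib, ← Finset.mul_sum, ← Finset.mul_sum,
          ← Finset.sum_div, ← Finset.sum_div]
        nth_rewrite 4 [hAdef]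
        nth_rewrite 4 [hBdef]
        ring
    _ = _ := by
        rw [div_self hA.ne', div_self hB.ne']
        ring

/-- Transition probabilities of a single coordinate under the noise operator with correlation
`r`. -/
def noiseKer (r : ℝ) (a b : Bool) : ℝ := if a = b then (1 + r) / 2 else (1 - r) / 2

/-- The noise operator on the cube whose correlation may depend on the coordinate. -/
def noise {F : Type*} [AddCommGroup F] [Module ℝ F] {n : ℕ} (τ : Fin n → ℝ) (f : Cube n → F) :
    Cube n → F :=
  fun x => ∑ y : Cube n, (∏ i, noiseKer (τ i) (x i) (y i)) • f y

lemma noiseKer_nonneg {r : ℝ} (h0 : 0 ≤ r) (h1 : r ≤ 1) (a b : Bool) : 0 ≤ noiseKer r a b := by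
  unfold noiseKer
  split_ifs <;> linarith

lemma noiseKer_mul (ρ r : ℝ) (a b : Bool) :
    noiseKer (ρ * r) a b = (1 + ρ) / 2 * noiseKer r a b + (1 - ρ) / 2 * noiseKer r (!a) b := by
  unfold noiseKer
  cases a <;> cases b <;> simp <;> ring

lemma flipC_flipC {n : ℕ} (i : Fin n) (x : Cube n) : flipC i (flipC i x) = x := by
  simp [flipC]

/-- Flipping a coordinate, as a permutation of the cube. -/
def flipEquiv {n : ℕ} (i : Fin n) : Equiv.Perm (Cube n) where
  toFun := flipC i
  invFun := flipC i
  left_inv := flipC_flipC i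
  right_inv := flipC_flipC i

lemma sum_flipC {F : Type*} [AddCommMonoid F] {n : ℕ} (i : Fin n) (g : Cube n → F) :
    ∑ x, g (flipC i x) = ∑ x, g x :=
  Equiv.sum_comp (flipEquiv i) g

section noise

variable {F : Type*} [NormedAddCommGroup F] [NormedSpace ℝ F] {n : ℕ}

lemma noise_update_mul (τ : Fin n → ℝ) (i : Fin n) (ρ : ℝ) (f : Cube n → F) (x : Cube n) :
    noise (Function.update τ i (ρ * τ i)) f x
      = ((1 + ρ) / 2) • noise τ f x + ((1 - ρ) / 2) • noise τ f (flipC i x) := by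
  simp only [noise, Finset.smul_sum, smul_smul, ← Finset.sum_add_distrib, ← add_smul]
  refine Finset.sum_congr rfl fun y _ => ?_
  congr 1
  have key : ∀ (τ' : Fin n → ℝ) (x' : Cube n), (∀ j, j ≠ i → τ' j = τ j) →
      (∀ j, j ≠ i → x' j = x j) → ∏ j, noiseKer (τ' j) (x' j) (y j)
        = noiseKer (τ' i) (x' i) (y i) * ∏ j ∈ univ.erase i, noiseKer (τ j) (x j) (y j) := by
    intro τ' x' hτ hx
    rw [← Finset.mul_prod_erase univ _ (Finset.mem_univ i)]
    congr 1
    refine Finset.prod_congr rfl fun j hj => ?_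
    rw [hτ j (Finset.ne_of_mem_erase hj), hx j (Finset.ne_of_mem_erase hj)]
  rw [key _ x (fun j hj => Function.update_of_ne hj _ _) fun _ _ => rfl,
    key τ x (fun _ _ => rfl) fun _ _ => rfl,
    key τ (flipC i x) (fun _ _ => rfl) fun j hj => Function.update_of_ne hj _ _]
  simp only [Function.update_self, flipC, noiseKer_mul]
  ring

lemma noise_flipC (τ : Fin n → ℝ) (i : Fin n) (f : Cube n → F) (x : Cube n) :
    noise τ f (flipC i x) = noise τ (fun y => f (flipC i y)) x := by
  unfold noise
  rw [← sum_flipC i]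
  refine Finset.sum_congr rfl fun y _ => ?_
  congr 1
  refine Finset.prod_congr rfl fun j _ => ?_
  by_cases hj : j = i
  · subst hj
    simp [flipC, noiseKer]
  · simp [flipC, hj]

lemma dparC_noise (τ : Fin n → ℝ) (i : Fin n) (f : Cube n → F) :
    dparC i (noise τ f) = noise τ (dparC i f) := by
  ext x
  unfold dparC
  rw [noise_flipC]
  simp only [noise, ← Finset.sum_sub_distrib, Finset.smul_sum]
  refine Finset.sum_congr rfl fun y _ => ?_
  rw [← smul_sub, smul_comm]

lemma norm_noise_le {τ : Fin n → ℝ} (h0 : ∀ i, 0 ≤ τ i) (h1 : ∀ i, τ i ≤ 1) (f : Cube n → F)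
    (x : Cube n) : ‖noise τ f x‖ ≤ noise τ (fun y => ‖f y‖) x := by
  refine (norm_sum_le _ _).trans (Finset.sum_le_sum fun y _ => ?_)
  rw [norm_smul, Real.norm_of_nonneg
    (Finset.prod_nonneg fun i _ => noiseKer_nonneg (h0 i) (h1 i) _ _), smul_eq_mul]

lemma noise_one (f : Cube n → F) : noise (fun _ => 1) f = f := by
  ext x
  unfold noise
  rw [Finset.sum_eq_single x]
  · simp [noiseKer]
  · intro y _ hy
    obtain ⟨i, hi⟩ := Function.ne_iff.1 hy
    rw [Finset.prod_eq_zero (Finset.mem_univ i), zero_smul]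
    simp [noiseKer, hi.symm]
  · simp

lemma noise_zero (f : Cube n → F) (x : Cube n) : noise (fun _ => 0) f x = cubeAvg f := by
  simp [noise, cubeAvg, noiseKer, Finset.smul_sum]

lemma noise_nonneg {τ : Fin n → ℝ} (h0 : ∀ i, 0 ≤ τ i) (h1 : ∀ i, τ i ≤ 1) {h : Cube n → ℝ}
    (hh : ∀ x, 0 ≤ h x) (x : Cube n) : 0 ≤ noise τ h x :=
  Finset.sum_nonneg fun y _ => mul_nonneg
    (Finset.prod_nonneg fun i _ => noiseKer_nonneg (h0 i) (h1 i) _ _) (hh y)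

/-- The mean squared increment of the noise martingale when one coordinate is refreshed. -/
lemma noise_increment (τ : Fin n → ℝ) (i : Fin n) {ρ : ℝ} (f : Cube n → F) (x : Cube n) :
    (1 + ρ) / 2 * ‖noise τ f x - noise (Function.update τ i (ρ * τ i)) f x‖ ^ 2
      + (1 - ρ) / 2 *
        ‖noise τ f (flipC i x) - noise (Function.update τ i (ρ * τ i)) f x‖ ^ 2
      = (1 - ρ ^ 2) * ‖noise τ (dparC i f) x‖ ^ 2 := by
  rw [← dparC_noise, noise_update_mul]
  set u := noise τ f x
  set w := noise τ f (flipC i x) with hw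
  have hD : dparC i (noise τ f) x = (2 : ℝ)⁻¹ • (u - w) := rfl
  have e1 : u - (((1 + ρ) / 2) • u + ((1 - ρ) / 2) • w) = (1 - ρ) • ((2 : ℝ)⁻¹ • (u - w)) := by
    module
  have e2 : w - (((1 + ρ) / 2) • u + ((1 - ρ) / 2) • w)
      = (-(1 + ρ)) • ((2 : ℝ)⁻¹ • (u - w)) := by
    module
  rw [e1, e2, hD, norm_smul (1 - ρ), norm_smul (-(1 + ρ)), mul_pow, mul_pow, Real.norm_eq_abs,
    Real.norm_eq_abs, sq_abs, sq_abs]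
  ring

end noise

lemma sum_cube_succ {F : Type*} [AddCommMonoid F] {n : ℕ} (g : Cube (n + 1) → F) :
    ∑ x, g x = ∑ x : Cube n, (g (Fin.cons true x) + g (Fin.cons false x)) := by
  rw [← Equiv.sum_comp (Fin.consEquiv fun _ => Bool), Fintype.sum_prod_type_right]
  simp only [Fintype.sum_bool]
  rfl

lemma noise_cons {n : ℕ} (τ : Fin (n + 1) → ℝ) (h : Cube (n + 1) → ℝ) (a : Bool) (x : Cube n) :
    noise τ h (Fin.cons a x : Cube (n + 1))
      = noiseKer (τ 0) a true * noise (fun i => τ i.succ) (fun y => h (Fin.cons true y)) x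
        + noiseKer (τ 0) a false *
          noise (fun i => τ i.succ) (fun y => h (Fin.cons false y)) x := by
  unfold noise
  rw [sum_cube_succ, Finset.sum_add_distrib, Finset.mul_sum, Finset.mul_sum]
  simp only [Fin.prod_univ_succ, Fin.cons_zero, Fin.cons_succ, smul_eq_mul, mul_assoc]

/-- Bonami's hypercontractive inequality from `L_p` to `L_2`, for nonnegative functions. -/
theorem noise_hypercontractive {p : ℝ} (hp1 : 1 ≤ p) (hp2 : p ≤ 2) {n : ℕ} (τ : Fin n → ℝ)
    (h0 : ∀ i, 0 ≤ τ i) (hτ : ∀ i, τ i ^ 2 ≤ p - 1) (h : Cube n → ℝ) (hh : ∀ x, 0 ≤ h x) :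
    (2 ^ n : ℝ)⁻¹ * ∑ x, noise τ h x ^ 2 ≤ ((2 ^ n : ℝ)⁻¹ * ∑ x, h x ^ p) ^ (2 / p) := by
  have hp0 : 0 < p := by linarith
  induction n with
  | zero =>
    simp only [noise, Fintype.sum_unique, Finset.univ_eq_empty, Finset.prod_empty, one_smul,
      pow_zero, inv_one, one_mul]
    rw [← Real.rpow_mul (hh _), show p * (2 / p) = (2 : ℕ) by field_simp; norm_num,
      Real.rpow_natCast]
  | succ n ih =>
    have h1 : ∀ i, τ i ≤ 1 := fun i => by nlinarith [hτ i, h0 i]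
    set c : ℝ := (2 ^ n : ℝ)⁻¹ with hc
    have hc0 : 0 ≤ c := by positivity
    set u : Bool → Cube n → ℝ := fun b =>
      noise (fun i => τ i.succ) (fun y => h (Fin.cons b y)) with hu
    have hu0 : ∀ b x, 0 ≤ u b x := fun b =>
      noise_nonneg (fun i => h0 _) (fun i => h1 _) fun y => hh _
    have hih : ∀ b, (c * ∑ x, u b x ^ 2) ^ (p / 2)
        ≤ c * ∑ x, h (Fin.cons b x : Cube (n + 1)) ^ p := by
      intro b
      have hS : 0 ≤ c * ∑ x, h (Fin.cons b x : Cube (n + 1)) ^ p :=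
        mul_nonneg hc0 (Finset.sum_nonneg fun x _ => Real.rpow_nonneg (hh _) _)
      calc (c * ∑ x, u b x ^ 2) ^ (p / 2)
          ≤ ((c * ∑ x, h (Fin.cons b x : Cube (n + 1)) ^ p) ^ (2 / p)) ^ (p / 2) :=
            Real.rpow_le_rpow (mul_nonneg hc0 (Finset.sum_nonneg fun x _ => sq_nonneg _))
              (ih _ (fun i => h0 _) (fun i => hτ _) _ fun y => hh _) (by positivity)
        _ = _ := by
          rw [← Real.rpow_mul hS, show 2 / p * (p / 2) = 1 by field_simp, Real.rpow_one]
    have hcs : (2 ^ (n + 1) : ℝ)⁻¹ = c / 2 := by rw [hc, pow_succ]; field_simp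
    calc (2 ^ (n + 1) : ℝ)⁻¹ * ∑ x, noise τ h x ^ 2
        = c * ∑ x : Cube n, (((u true x + u false x) / 2) ^ 2
            + τ 0 ^ 2 * ((u true x - u false x) / 2) ^ 2) := by
          rw [hcs, sum_cube_succ, Finset.mul_sum, Finset.mul_sum]
          refine Finset.sum_congr rfl fun x _ => ?_
          rw [noise_cons, noise_cons]
          simp only [noiseKer, hu]
          simp
          ring
      _ ≤ c * ∑ x : Cube n, ((u true x ^ p + u false x ^ p) / 2) ^ (2 / p) := by
          gcongr with x
          exact two_point_hypercontractive hp1 hp2 (hτ 0) (hu0 _ _) (hu0 _ _)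
      _ ≤ (((c * ∑ x, u true x ^ 2) ^ (p / 2) + (c * ∑ x, u false x ^ 2) ^ (p / 2)) / 2)
            ^ (2 / p) :=
          weighted_sum_rpow_half_add_le _ hp1 hp2 hc0 (hu0 _) (hu0 _)
      _ ≤ ((2 ^ (n + 1) : ℝ)⁻¹ * ∑ x, h x ^ p) ^ (2 / p) := by
          have hnn : ∀ b, 0 ≤ c * ∑ x, u b x ^ 2 := fun b =>
            mul_nonneg hc0 (Finset.sum_nonneg fun x _ => sq_nonneg _)
          refine Real.rpow_le_rpow ?_ ?_ (by positivity)
          · have := Real.rpow_nonneg (hnn true) (p / 2)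
            have := Real.rpow_nonneg (hnn false) (p / 2)
            linarith
          · rw [hcs, sum_cube_succ, Finset.sum_add_distrib]
            linarith [hih true, hih false]

/-- The martingale type 2 inequality with constant `M`, over probability spaces in `Type`. -/
def MartingaleTypeTwo (F : Type*) [NormedAddCommGroup F] [NormedSpace ℝ F] (M : ℝ) : Prop :=
  ∀ (Ω : Type) (mΩ : MeasurableSpace Ω) (μ : Measure Ω),
    IsProbabilityMeasure μ → ∀ (ℱ : Filtration ℕ mΩ) (g : ℕ → Ω → F),
      Martingale g ℱ μ → ∀ N : ℕ,
        ∫ ω, ‖g N ω - g 0 ω‖ ^ 2 ∂μ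
          ≤ M ^ 2 * ∑ i ∈ Finset.range N, ∫ ω, ‖g (i + 1) ω - g i ω‖ ^ 2 ∂μ

section chain

variable {S : Type} {N : ℕ}

/-- The chain started at `ω.1` that, at time `m`, stays put if `ω.2 m` is true and otherwise
moves by the permutation `e m`. -/
def chainState (e : ℕ → Equiv.Perm S) (ω : S × Cube N) : ℕ → S
  | 0 => ω.1
  | m + 1 =>
    if h : m < N then
      if ω.2 ⟨m, h⟩ then chainState e ω m else e m (chainState e ω m)
    else chainState e ω m

/-- The part of the randomness revealed before time `m`. -/
def chainPast (m : ℕ) (ω : S × Cube N) : S × Cube N :=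
  (ω.1, fun j => if (j : ℕ) < m then ω.2 j else true)

/-- The law of the starting point and of the independent coins driving the chain. -/
def chainWeight [Fintype S] (q : ℕ → Bool → ℝ) (ω : S × Cube N) : ℝ :=
  (Fintype.card S : ℝ)⁻¹ * ∏ j : Fin N, q j (ω.2 j)

lemma chainState_congr (e : ℕ → Equiv.Perm S) {ω ω' : S × Cube N} (h1 : ω.1 = ω'.1) {m : ℕ}
    (h2 : ∀ j : Fin N, (j : ℕ) < m → ω.2 j = ω'.2 j) :
    chainState e ω m = chainState e ω' m := by
  induction m with
  | zero => exact h1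
  | succ m ih =>
    have := ih fun j hj => h2 j (hj.trans m.lt_succ_self)
    simp only [chainState, this]
    split_ifs with h ha hb hb
    · rfl
    · exact absurd (h2 ⟨m, h⟩ m.lt_succ_self ▸ ha) hb
    · exact absurd ((h2 ⟨m, h⟩ m.lt_succ_self).symm ▸ hb) ha
    · rfl
    · rfl

lemma chainState_chainPast (e : ℕ → Equiv.Perm S) (ω : S × Cube N) {m k : ℕ} (h : m ≤ k) :
    chainState e (chainPast k ω) m = chainState e ω m :=
  chainState_congr (ω := chainPast k ω) (ω' := ω) e rfl fun _ hj => if_pos (hj.trans_le h)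

lemma chainState_flipC (e : ℕ → Equiv.Perm S) (ω : S × Cube N) (k : Fin N) :
    chainState e (ω.1, flipC k ω.2) k = chainState e ω k :=
  chainState_congr (ω := (ω.1, flipC k ω.2)) (ω' := ω) e rfl
    fun _ hj => Function.update_of_ne (Fin.ne_of_lt hj) _ _

lemma chainPast_flipC (ω : S × Cube N) (k : Fin N) :
    chainPast (k : ℕ) (ω.1, flipC k ω.2) = chainPast (k : ℕ) ω := by
  unfold chainPast
  congr 1
  ext j
  by_cases hj : (j : ℕ) < k
  · simp [hj, flipC, Function.update_of_ne (Fin.ne_of_lt hj)]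
  · simp [hj]

lemma chainPast_chainPast {k m : ℕ} (h : k ≤ m) (ω : S × Cube N) :
    chainPast k (chainPast m ω) = chainPast k ω := by
  unfold chainPast
  congr 1
  ext j
  by_cases hj : (j : ℕ) < k
  · simp [hj, hj.trans_le h]
  · simp [hj]

variable [Fintype S] {q : ℕ → Bool → ℝ}

lemma chainWeight_nonneg (hq0 : ∀ m b, 0 ≤ q m b) (ω : S × Cube N) : 0 ≤ chainWeight q ω :=
  mul_nonneg (by positivity) (Finset.prod_nonneg fun _ _ => hq0 _ _)

lemma chainWeight_flipC (ω : S × Cube N) (k : Fin N) :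
    chainWeight q (ω.1, flipC k ω.2) * q k (ω.2 k) = chainWeight q ω * q k (!ω.2 k) := by
  unfold chainWeight
  rw [← Finset.mul_prod_erase univ _ (Finset.mem_univ k),
    ← Finset.mul_prod_erase univ (fun j : Fin N => q j (ω.2 j)) (Finset.mem_univ k)]
  have : ∏ j ∈ univ.erase k, q j (flipC k ω.2 j) = ∏ j ∈ univ.erase k, q j (ω.2 j) :=
    Finset.prod_congr rfl fun j hj => by
      rw [flipC, Function.update_of_ne (Finset.ne_of_mem_erase hj)]
  simp only [this]
  simp only [flipC, Function.update_self]
  ring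

lemma sum_chainWeight_mul_start (hq1 : ∀ m, q m true + q m false = 1) (G : S → ℝ) :
    ∑ ω : S × Cube N, chainWeight q ω * G ω.1 = (Fintype.card S : ℝ)⁻¹ * ∑ x, G x := by
  have h : ∑ b : Cube N, ∏ j : Fin N, q j (b j) = 1 := by
    have := Finset.prod_univ_sum (fun _ : Fin N => (univ : Finset Bool))
      (fun j b => q (j : ℕ) b)
    rw [Fintype.piFinset_univ] at this
    rw [← this]
    simp [hq1]
  rw [Fintype.sum_prod_type, Finset.mul_sum]
  refine Finset.sum_congr rfl fun x _ => ?_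
  simp only [chainWeight, mul_right_comm _ _ (G x)]
  rw [← Finset.mul_sum, h, mul_one]

/-- Refreshing one coin does not change expectations. -/
lemma sum_chainWeight_refresh {F : Type*} [AddCommGroup F] [Module ℝ F]
    (hq1 : ∀ m, q m true + q m false = 1) (k : Fin N) (G : S × Cube N → F) :
    ∑ ω, chainWeight q ω • G ω
      = ∑ ω, chainWeight q ω • (q k (ω.2 k) • G ω + q k (!ω.2 k) • G (ω.1, flipC k ω.2)) := by
  have hflip : ∀ H : S × Cube N → F, ∑ ω : S × Cube N, H (ω.1, flipC k ω.2) = ∑ ω, H ω := fun H =>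
    Equiv.sum_comp ((Equiv.refl S).prodCongr (flipEquiv k)) H
  simp only [smul_add, Finset.sum_add_distrib]
  rw [← hflip fun ω : S × Cube N => chainWeight q ω • q k (!ω.2 k) • G (ω.1, flipC k ω.2),
    ← Finset.sum_add_distrib]
  refine Finset.sum_congr rfl fun ω _ => ?_
  have hk : (!flipC k ω.2 k) = ω.2 k := by simp [flipC]
  rw [hk, flipC_flipC, smul_smul, smul_smul, ← add_smul, chainWeight_flipC, ← mul_add]
  have : q k (ω.2 k) + q k (!ω.2 k) = 1 := by
    cases ω.2 k
    · rw [add_comm]; exact hq1 k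
    · exact hq1 k
  rw [this, mul_one]

/-- The transition rule of the chain, tested against the past. -/
lemma sum_chainWeight_step {F : Type*} [AddCommGroup F] [Module ℝ F]
    (hq1 : ∀ m, q m true + q m false = 1) (e : ℕ → Equiv.Perm S) {m : ℕ} (hm : m < N)
    (ψ : S × Cube N → ℝ) (G : S → S → F) :
    ∑ ω, chainWeight q ω •
        (ψ (chainPast m ω) • G (chainState e ω m) (chainState e ω (m + 1)))
      = ∑ ω, chainWeight q ω • (ψ (chainPast m ω) •
          (q m true • G (chainState e ω m) (chainState e ω m)
            + q m false • G (chainState e ω m) (e m (chainState e ω m)))) := by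
  rw [sum_chainWeight_refresh hq1 ⟨m, hm⟩]
  refine Finset.sum_congr rfl fun ω _ => ?_
  congr 1
  have h1 := chainState_flipC e ω ⟨m, hm⟩
  have h2 := chainPast_flipC ω ⟨m, hm⟩
  simp only at h1 h2
  simp only [h2, smul_comm (q m _) (ψ _), ← smul_add]
  congr 1
  simp only [chainState, h1, hm, dif_pos]
  cases hω : ω.2 ⟨m, hm⟩
  · simp [flipC, hω, add_comm]
  · simp [flipC, hω]

/-- The chain is stationary for the uniform distribution. -/
lemma sum_chainWeight_mul_state (hq1 : ∀ m, q m true + q m false = 1) (e : ℕ → Equiv.Perm S)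
    {m : ℕ} (hm : m ≤ N) (G : S → ℝ) :
    ∑ ω : S × Cube N, chainWeight q ω * G (chainState e ω m)
      = (Fintype.card S : ℝ)⁻¹ * ∑ x, G x := by
  induction m generalizing G with
  | zero => exact sum_chainWeight_mul_start hq1 G
  | succ m ih =>
    have := sum_chainWeight_step hq1 e (Nat.lt_of_succ_le hm) (fun _ => 1) (fun _ y => G y)
    simp only [one_mul, smul_eq_mul] at this
    rw [this, ih (m.le_succ.trans hm) fun x => q m true * G x + q m false * G (e m x),
      Finset.sum_add_distrib, ← Finset.mul_sum, ← Finset.mul_sum, Equiv.sum_comp (e m) G,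
      ← add_mul, hq1, one_mul]

/-- The martingale type 2 inequality for space-time harmonic functions of a stationary chain with
deterministic initial value. -/
theorem MartingaleTypeTwo.sum_chain_le [Nonempty S] {F : Type*} [NormedAddCommGroup F]
    [NormedSpace ℝ F] [CompleteSpace F] {M : ℝ} (hF : MartingaleTypeTwo F M)
    (hq0 : ∀ m b, 0 ≤ q m b) (hq1 : ∀ m, q m true + q m false = 1) (e : ℕ → Equiv.Perm S)
    (g : ℕ → S → F) (N : ℕ)
    (hg : ∀ m < N, ∀ x, g m x = q m true • g (m + 1) x + q m false • g (m + 1) (e m x))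
    (c : F) (hc : ∀ x, g 0 x = c) :
    ∑ x, ‖g N x - c‖ ^ 2 ≤ M ^ 2 * ∑ m ∈ Finset.range N, ∑ x,
      (q m true * ‖g (m + 1) x - g m x‖ ^ 2
        + q m false * ‖g (m + 1) (e m x) - g m x‖ ^ 2) := by
  have hcard : (0 : ℝ) < Fintype.card S := by exact_mod_cast Fintype.card_pos
  have hw0 : ∀ ω : S × Cube N, 0 ≤ chainWeight q ω := chainWeight_nonneg hq0
  have hw1 : ∑ ω : S × Cube N, ENNReal.ofReal (chainWeight q ω) = 1 := by
    rw [← ENNReal.ofReal_sum_of_nonneg fun ω _ => hw0 ω]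
    have := sum_chainWeight_mul_start (N := N) hq1 fun _ : S => 1
    simp only [mul_one, Finset.sum_const, Finset.card_univ, nsmul_eq_mul] at this
    rw [this, inv_mul_cancel₀ hcard.ne', ENNReal.ofReal_one]
  let mΩ : MeasurableSpace (S × Cube N) := ⊤
  let P : PMF (S × Cube N) := PMF.ofFintype _ hw1
  have h_integral : ∀ h : S × Cube N → F, ∫ ω, h ω ∂P.toMeasure = ∑ ω, chainWeight q ω • h ω := by
    intro h
    rw [PMF.integral_eq_sum]
    refine Finset.sum_congr rfl fun ω _ => ?_
    rw [PMF.ofFintype_apply, ENNReal.toReal_ofReal (hw0 ω)]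
  have h_integral_real : ∀ h : S × Cube N → ℝ,
      ∫ ω, h ω ∂P.toMeasure = ∑ ω, chainWeight q ω * h ω := by
    intro h
    rw [PMF.integral_eq_sum]
    refine Finset.sum_congr rfl fun ω _ => ?_
    rw [PMF.ofFintype_apply, ENNReal.toReal_ofReal (hw0 ω), smul_eq_mul]
  let ℱ : Filtration ℕ mΩ :=
    { seq := fun m => MeasurableSpace.comap (chainPast m) ⊤
      mono' := by
        rintro k m hkm _ ⟨A, _, rfl⟩
        refine ⟨chainPast k ⁻¹' A, trivial, ?_⟩
        ext ω
        simp only [Set.mem_preimage, chainPast_chainPast hkm]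
      le' := fun _ => le_top }
  let Y : ℕ → S × Cube N → F := fun m ω => g (min m N) (chainState e ω m)
  have hY : Martingale Y ℱ P.toMeasure := by
    refine martingale_of_setIntegral_eq_succ ?_ (fun _ => .of_finite) ?_
    · intro m
      have : Y m = Y m ∘ chainPast m := by
        ext ω
        simp only [Y, Function.comp, chainState_chainPast e ω le_rfl]
      rw [this]
      exact StronglyMeasurable.of_discrete.comp_measurable (comap_measurable _)
    · rintro m _ ⟨A, _, rfl⟩
      rcases lt_or_ge m N with hm | hm
      · have hA : MeasurableSet (chainPast m ⁻¹' A : Set (S × Cube N)) := trivial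
        rw [← integral_indicator hA, ← integral_indicator hA, ← sub_eq_zero,
          ← neg_eq_zero, neg_sub, h_integral, h_integral, ← Finset.sum_sub_distrib]
        have hstep := sum_chainWeight_step (N := N) hq1 e hm (A.indicator 1)
          (fun x y => g (m + 1) y - g m x)
        have hzero : ∀ x, q m true • (g (m + 1) x - g m x)
            + q m false • (g (m + 1) (e m x) - g m x) = 0 := by
          intro x
          rw [smul_sub, smul_sub, sub_add_sub_comm, ← hg m hm, ← add_smul, hq1, one_smul,
            sub_self]
        simp only [hzero, smul_zero, Finset.sum_const_zero] at hstep
        rw [← hstep]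
        refine Finset.sum_congr rfl fun ω _ => ?_
        rw [← smul_sub]
        congr 1
        by_cases hω : chainPast m ω ∈ A
        · simp [Set.indicator, hω, Y, min_eq_left hm.le, min_eq_left (Nat.succ_le_of_lt hm)]
        · simp [Set.indicator, hω]
      · have : Y (m + 1) = Y m := by
          ext ω
          simp [Y, chainState, hm.not_gt, min_eq_right hm, min_eq_right (hm.trans m.le_succ)]
        rw [this]
  have hmain := hF _ mΩ P.toMeasure inferInstance ℱ Y hY N
  have hL : ∫ ω, ‖Y N ω - Y 0 ω‖ ^ 2 ∂P.toMeasure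
      = (Fintype.card S : ℝ)⁻¹ * ∑ x, ‖g N x - c‖ ^ 2 := by
    rw [h_integral_real, ← sum_chainWeight_mul_state hq1 e (le_refl N)]
    simp [Y, hc]
  have hR : ∀ m ∈ Finset.range N, ∫ ω, ‖Y (m + 1) ω - Y m ω‖ ^ 2 ∂P.toMeasure
      = (Fintype.card S : ℝ)⁻¹ * ∑ x, (q m true * ‖g (m + 1) x - g m x‖ ^ 2
        + q m false * ‖g (m + 1) (e m x) - g m x‖ ^ 2) := by
    intro m hm
    have hm := Finset.mem_range.1 hm
    have hstep := sum_chainWeight_step (N := N) hq1 e hm (fun _ => 1)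
      (fun x y => ‖g (m + 1) y - g m x‖ ^ 2)
    simp only [one_mul, smul_eq_mul] at hstep
    rw [h_integral_real, ← sum_chainWeight_mul_state hq1 e hm.le, ← hstep]
    simp only [Y, min_eq_left hm.le, min_eq_left (Nat.succ_le_of_lt hm)]
  rw [hL, Finset.sum_congr rfl hR, ← Finset.mul_sum, mul_left_comm] at hmain
  exact le_of_mul_le_mul_left hmain (inv_pos.2 hcard)

end chain

/-- The number of times coordinate `j` is refreshed among the first `m` steps of the cyclic
schedule on `n` coordinates. -/
def refreshCount (n m j : ℕ) : ℕ := (m + (n - 1 - j)) / n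

lemma refreshCount_mul_add {n i j : ℕ} (l : ℕ) (hi : i ≤ n) (hj : j < n) :
    refreshCount n (n * l + i) j = l + if j < i then 1 else 0 := by
  have hn : 0 < n := by omega
  rw [refreshCount, show n * l + i + (n - 1 - j) = (i + (n - 1 - j)) + n * l by ring,
    Nat.add_mul_div_left _ _ hn, add_comm]
  congr 1
  split_ifs with h
  · exact Nat.div_eq_of_lt_le (by omega) (by omega)
  · exact Nat.div_eq_of_lt (by omega)

lemma sum_range_mul_div_mod {n : ℕ} (K : ℕ) (φ : ℕ → Fin n → ℝ) (hn : 0 < n) :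
    ∑ m ∈ Finset.range (n * K), φ (m / n) ⟨m % n, Nat.mod_lt m hn⟩
      = ∑ l ∈ Finset.range K, ∑ i, φ l i := by
  induction K with
  | zero => simp
  | succ K ih =>
    rw [Nat.mul_succ, Finset.sum_range_add, ih, Finset.sum_range_succ, ← Fin.sum_univ_eq_sum_range
      fun m => φ ((n * K + m) / n) ⟨(n * K + m) % n, Nat.mod_lt _ hn⟩]
    congr 1
    refine Finset.sum_congr rfl fun i _ => ?_
    congr 1
    · rw [Nat.mul_add_div hn, Nat.div_eq_of_lt i.2, add_zero]
    · ext
      simp [Nat.mod_eq_of_lt i.2]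

section semigroup

variable {F : Type*} [NormedAddCommGroup F] [NormedSpace ℝ F] [CompleteSpace F] {M : ℝ}

/-- Martingale type 2 applied to the noise martingale along a path of correlation vectors which
changes one coordinate at a time. -/
lemma MartingaleTypeTwo.sum_noise_le (hF : MartingaleTypeTwo F M) {n : ℕ} (f : Cube n → F)
    (N : ℕ) (τ : ℕ → Fin n → ℝ) (i : ℕ → Fin n) (ρ : ℕ → ℝ) (hρ0 : ∀ m, 0 ≤ ρ m)
    (hρ1 : ∀ m, ρ m ≤ 1) (hτ0 : τ 0 = fun _ => 0) (hτN : τ N = fun _ => 1)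
    (hτ : ∀ m < N, τ m = Function.update (τ (m + 1)) (i m) (ρ m * τ (m + 1) (i m))) :
    ∑ x, ‖f x - cubeAvg f‖ ^ 2 ≤ M ^ 2 * ∑ m ∈ Finset.range N,
      (1 - ρ m ^ 2) * ∑ x, ‖noise (τ (m + 1)) (dparC (i m) f) x‖ ^ 2 := by
  have h := hF.sum_chain_le (S := Cube n)
    (q := fun m b => if b then (1 + ρ m) / 2 else (1 - ρ m) / 2)
    (fun m b => by
      have := hρ0 m
      have := hρ1 m
      split_ifs <;> linarith)
    (fun m => by simp; ring) (fun m => flipEquiv (i m)) (fun m => noise (τ m) f) N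
    (fun m hm x => by
      rw [hτ m hm, noise_update_mul]
      simp [flipEquiv])
    (cubeAvg f) (fun x => by rw [hτ0, noise_zero])
  simp only [hτN, noise_one] at h
  refine h.trans_eq ?_
  congr 1
  refine Finset.sum_congr rfl fun m hm => ?_
  rw [Finset.mul_sum]
  refine Finset.sum_congr rfl fun x _ => ?_
  rw [hτ m (Finset.mem_range.1 hm), ← noise_increment]
  simp [flipEquiv]

/-- A Riemann-sum form of the heat flow estimate in spaces of martingale type 2. -/
lemma MartingaleTypeTwo.cubeAvg_le (hF : MartingaleTypeTwo F M) {n : ℕ} (f : Cube n → F)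
    (K : ℕ) (s : ℕ → ℝ) (hs0 : s 0 = 0) (hsK : s K = 1) (hmono : Monotone s)
    (hpos : ∀ l, 0 < s (l + 1)) :
    (2 ^ n : ℝ)⁻¹ * ∑ x, ‖f x - cubeAvg f‖ ^ 2 ≤ M ^ 2 * ∑ l ∈ Finset.range K, ∑ i : Fin n,
      (1 - s l / s (l + 1)) *
        ((2 ^ n : ℝ)⁻¹ * ∑ x, ‖dparC i f x‖ ^ (1 + s (l + 1))) ^ (2 / (1 + s (l + 1))) := by
  have hs_nonneg : ∀ l, 0 ≤ s l := fun l => hs0 ▸ hmono (Nat.zero_le l)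
  rcases Nat.eq_zero_or_pos n with rfl | hn
  · have : ∀ x, f x = cubeAvg f := fun x => by
      rw [cubeAvg, Fintype.sum_subsingleton _ x]
      simp
    simp only [sub_eq_zero.2 (this _)]
    simp
  have hratio : ∀ l, 0 ≤ s l / s (l + 1) ∧ s l / s (l + 1) ≤ 1 := fun l =>
    ⟨div_nonneg (hs_nonneg l) (hpos l).le, (div_le_one (hpos l)).2 (hmono l.le_succ)⟩
  have h := hF.sum_noise_le f (n * K) (fun m j => √(s (refreshCount n m j)))
    (fun m => ⟨m % n, Nat.mod_lt m hn⟩) (fun m => √(s (m / n) / s (m / n + 1)))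
    (fun m => Real.sqrt_nonneg _) (fun m => Real.sqrt_le_one.2 (hratio _).2)
    (by
      ext j
      have := refreshCount_mul_add 0 (Nat.zero_le n) j.2
      simp only [mul_zero, add_zero, Nat.not_lt_zero, if_false] at this
      simp [this, hs0])
    (by
      ext j
      have := refreshCount_mul_add K (Nat.zero_le n) j.2
      simp only [add_zero, Nat.not_lt_zero, if_false] at this
      simp [this, hsK])
    (by
      intro m _
      ext j
      have hm := Nat.div_add_mod m n
      have hlt := Nat.mod_lt m hn
      have h1 := refreshCount_mul_add (m / n) hlt.le j.2
      have h2 := refreshCount_mul_add (m / n) (Nat.succ_le_of_lt hlt) j.2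
      rw [Nat.succ_eq_add_one, ← add_assoc] at h2
      rw [hm] at h1 h2
      by_cases hj : j = ⟨m % n, hlt⟩
      · subst hj
        simp only [lt_irrefl, if_false, add_zero, Nat.lt_succ_self, if_true] at h1 h2
        simp only [Function.update_self, h1, h2]
        rw [← Real.sqrt_mul (hratio _).1, div_mul_cancel₀ _ (hpos _).ne']
      · have hj' : (j : ℕ) ≠ m % n := fun h => hj (Fin.ext h)
        rw [Function.update_of_ne hj, h1, h2]
        congr 3
        exact if_congr (by omega) rfl rfl)
  have hterm : ∀ m ∈ Finset.range (n * K), (1 - √(s (m / n) / s (m / n + 1)) ^ 2) *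
      ((2 ^ n : ℝ)⁻¹ * ∑ x, ‖noise (fun j : Fin n => √(s (refreshCount n (m + 1) j)))
        (dparC ⟨m % n, Nat.mod_lt m hn⟩ f) x‖ ^ 2)
      ≤ (1 - s (m / n) / s (m / n + 1)) * ((2 ^ n : ℝ)⁻¹ *
        ∑ x, ‖dparC ⟨m % n, Nat.mod_lt m hn⟩ f x‖ ^ (1 + s (m / n + 1)))
          ^ (2 / (1 + s (m / n + 1))) := by
    intro m hm
    have hmK : m / n < K := Nat.div_lt_of_lt_mul (Finset.mem_range.1 hm)
    rw [Real.sq_sqrt (hratio _).1]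
    have hs1 : s (m / n + 1) ≤ 1 := hsK ▸ hmono hmK
    have hle : ∀ j : Fin n, s (refreshCount n (m + 1) j) ≤ s (m / n + 1) := by
      intro j
      have h2 := refreshCount_mul_add (m / n) (Nat.succ_le_of_lt (Nat.mod_lt m hn)) j.2
      rw [Nat.succ_eq_add_one, ← add_assoc, Nat.div_add_mod] at h2
      rw [h2]
      refine hmono ?_
      split_ifs <;> omega
    refine mul_le_mul_of_nonneg_left ?_ (sub_nonneg.2 (hratio _).2)
    refine le_trans ?_ (noise_hypercontractive (p := 1 + s (m / n + 1))
      (by linarith [hpos (m / n)]) (by linarith)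
      (fun j : Fin n => √(s (refreshCount n (m + 1) j))) (fun j => Real.sqrt_nonneg _)
      (fun j => by rw [Real.sq_sqrt (hs_nonneg _)]; linarith [hle j])
      (fun x => ‖dparC ⟨m % n, Nat.mod_lt m hn⟩ f x‖) fun x => norm_nonneg _)
    gcongr with x
    exact norm_noise_le (fun j => Real.sqrt_nonneg _)
      (fun j => Real.sqrt_le_one.2 ((hle j).trans hs1)) _ x
  rw [← sum_range_mul_div_mod K (fun l i => (1 - s l / s (l + 1)) * ((2 ^ n : ℝ)⁻¹ *
    ∑ x, ‖dparC i f x‖ ^ (1 + s (l + 1))) ^ (2 / (1 + s (l + 1)))) hn]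
  refine le_trans (mul_le_mul_of_nonneg_left h (by positivity)) ?_
  rw [mul_left_comm, Finset.mul_sum]
  refine mul_le_mul_of_nonneg_left (Finset.sum_le_sum fun m hm => ?_) (sq_nonneg M)
  rw [mul_left_comm]
  exact hterm m hm

end semigroup

lemma cubeLp_two_sq {F : Type*} [NormedAddCommGroup F] {n : ℕ} (g : Cube n → F) :
    cubeLp 2 g ^ 2 = (2 ^ n : ℝ)⁻¹ * ∑ x, ‖g x‖ ^ 2 := by
  have h : (0 : ℝ) ≤ (2 ^ n : ℝ)⁻¹ * ∑ x, ‖g x‖ ^ 2 := by positivity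
  simp only [cubeLp, Real.rpow_two, ← Real.sqrt_eq_rpow]
  exact Real.sq_sqrt h

lemma cubeLp_one {F : Type*} [NormedAddCommGroup F] {n : ℕ} (g : Cube n → F) :
    cubeLp 1 g = (2 ^ n : ℝ)⁻¹ * ∑ x, ‖g x‖ := by
  simp [cubeLp]

lemma cubeLp_nonneg {F : Type*} [NormedAddCommGroup F] {n : ℕ} (p : ℝ) (g : Cube n → F) :
    0 ≤ cubeLp p g :=
  Real.rpow_nonneg (mul_nonneg (by positivity)
    (Finset.sum_nonneg fun _ _ => Real.rpow_nonneg (norm_nonneg _) _)) _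

lemma cubeLp_one_le_two {F : Type*} [NormedAddCommGroup F] {n : ℕ} (g : Cube n → F) :
    cubeLp 1 g ≤ cubeLp 2 g := by
  refine le_of_sq_le_sq ?_ (cubeLp_nonneg _ _)
  rw [cubeLp_two_sq, cubeLp_one, mul_pow]
  have h := sq_sum_le_card_mul_sum_sq (s := (univ : Finset (Cube n))) (f := fun x => ‖g x‖)
  simp only [Finset.card_univ, Fintype.card_fun, Fintype.card_bool, Fintype.card_fin] at h
  push_cast at h
  calc ((2 ^ n : ℝ)⁻¹) ^ 2 * (∑ x, ‖g x‖) ^ 2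
      ≤ ((2 ^ n : ℝ)⁻¹) ^ 2 * (2 ^ n * ∑ x, ‖g x‖ ^ 2) := by gcongr
    _ = _ := by field_simp

lemma cubeLp_one_pos {F : Type*} [NormedAddCommGroup F] {n : ℕ} {g : Cube n → F}
    (hg : ∃ x, g x ≠ 0) : 0 < cubeLp 1 g := by
  obtain ⟨x, hx⟩ := hg
  rw [cubeLp_one]
  exact mul_pos (by positivity) (Finset.sum_pos' (fun y _ => norm_nonneg _)
    ⟨x, Finset.mem_univ x, norm_pos_iff.2 hx⟩)

lemma log_cubeLp_div_nonneg {F : Type*} [NormedAddCommGroup F] {n : ℕ} (g : Cube n → F) :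
    0 ≤ Real.log (cubeLp 2 g / cubeLp 1 g) := by
  by_cases hg : ∃ x, g x ≠ 0
  · exact Real.log_nonneg ((one_le_div (cubeLp_one_pos hg)).2 (cubeLp_one_le_two g))
  · push Not at hg
    simp [cubeLp_one, hg]

/-- Interpolation of the `L_{1+s}` norm between `L_1` and `L_2`. -/
lemma cube_sum_rpow_le {F : Type*} [NormedAddCommGroup F] {n : ℕ} (g : Cube n → F) {s : ℝ}
    (hs0 : 0 ≤ s) (hs1 : s ≤ 1) :
    ((2 ^ n : ℝ)⁻¹ * ∑ x, ‖g x‖ ^ (1 + s)) ^ (2 / (1 + s))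
      ≤ cubeLp 2 g ^ 2 * Real.exp (-(Real.log (cubeLp 2 g / cubeLp 1 g) * (1 - s))) := by
  have hp : 0 < 1 + s := by linarith
  by_cases hg : ∃ x, g x ≠ 0
  swap
  · push Not at hg
    have : (0 : ℝ) < 2 / (1 + s) := by positivity
    simp [cubeLp_two_sq, hg, Real.zero_rpow hp.ne', Real.zero_rpow this.ne']
  have hA := cubeLp_one_pos hg
  have hB := hA.trans_le (cubeLp_one_le_two g)
  have hL := log_cubeLp_div_nonneg g
  have h_interp := weighted_sum_rpow_le univ (p := 1 + s) (c := (2 ^ n : ℝ)⁻¹) (by linarith)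
    (by linarith) (fun x => norm_nonneg (g x)) (by positivity) (by rwa [← cubeLp_one])
    (by rw [← cubeLp_two_sq]; positivity)
  rw [← cubeLp_one, ← cubeLp_two_sq] at h_interp
  rw [Real.log_div hB.ne' hA.ne'] at hL ⊢
  set A := cubeLp 1 g
  set B := cubeLp 2 g
  calc ((2 ^ n : ℝ)⁻¹ * ∑ x, ‖g x‖ ^ (1 + s)) ^ (2 / (1 + s))
      ≤ (A ^ (2 - (1 + s)) * (B ^ 2) ^ (1 + s - 1)) ^ (2 / (1 + s)) :=
        Real.rpow_le_rpow (mul_nonneg (by positivity)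
          (Finset.sum_nonneg fun _ _ => Real.rpow_nonneg (norm_nonneg _) _)) h_interp
          (by positivity)
    _ = Real.exp ((Real.log A * (2 - (1 + s)) + 2 * Real.log B * (1 + s - 1)) *
          (2 / (1 + s))) := by
        rw [Real.rpow_def_of_pos hA, Real.rpow_def_of_pos (by positivity : 0 < B ^ 2),
          ← Real.exp_add, ← Real.exp_mul, Real.log_pow]
        norm_num
    _ ≤ Real.exp (2 * Real.log B - (Real.log B - Real.log A) * (1 - s)) := by
        refine Real.exp_le_exp.2 ?_
        rw [mul_div_assoc', div_le_iff₀ hp]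
        nlinarith [mul_nonneg hL (mul_nonneg (sub_nonneg.2 hs1) (sub_nonneg.2 hs1))]
    _ = B ^ 2 * Real.exp (-((Real.log B - Real.log A) * (1 - s))) := by
        rw [sub_eq_add_neg, Real.exp_add, two_mul, Real.exp_add, Real.exp_log hB, sq]

/-- The time schedule: an initial jump to `1/2` followed by `K` equal steps up to `1`. -/
def schedule (K l : ℕ) : ℝ := if l = 0 then 0 else (1 + ((l : ℝ) - 1) / K) / 2

lemma schedule_succ (K l : ℕ) : schedule K (l + 1) = (1 + (l : ℝ) / K) / 2 := by
  simp [schedule]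

lemma schedule_succ_pos (K l : ℕ) : 0 < schedule K (l + 1) := by
  rw [schedule_succ]
  positivity

lemma schedule_mono (K : ℕ) : Monotone (schedule K) := by
  refine monotone_nat_of_le_succ fun l => ?_
  rcases l with _ | l
  · exact (schedule_succ_pos K 0).le
  · rw [schedule_succ, schedule_succ]
    gcongr
    linarith

lemma schedule_last {K : ℕ} (hK : 0 < K) : schedule K (K + 1) = 1 := by
  have : (K : ℝ) ≠ 0 := by positivity
  rw [schedule_succ, div_self this]
  norm_num

lemma geom_exp_sum_le {L : ℝ} {K : ℕ} (hL : 0 ≤ L) (hK : 0 < K) (hLK : L ≤ K) :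
    (K : ℝ)⁻¹ * ∑ j ∈ Finset.range K, Real.exp (-(L / (2 * K))) ^ j ≤ 4 / (1 + L) := by
  have hK' : (0 : ℝ) < K := by exact_mod_cast hK
  set y := L / (2 * K) with hy
  have hy0 : 0 ≤ y := by positivity
  set S := ∑ j ∈ Finset.range K, Real.exp (-y) ^ j with hS
  have he1 : Real.exp (-y) ≤ 1 := Real.exp_le_one_iff.2 (by linarith)
  have hS0 : 0 ≤ S := by positivity
  have hSK : S ≤ K := by
    calc S ≤ ∑ j ∈ Finset.range K, (1 : ℝ) :=
          Finset.sum_le_sum fun j _ => pow_le_one₀ (Real.exp_pos _).le he1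
      _ = K := by simp
  have hgeom : S * (1 - Real.exp (-y)) ≤ 1 := by
    have := geom_sum_mul_neg (Real.exp (-y)) K
    rw [← hS] at this
    rw [this]
    linarith [pow_nonneg (Real.exp_pos (-y)).le K]
  have hexp : y ≤ (1 + y) * (1 - Real.exp (-y)) := by
    have h1 := Real.add_one_le_exp y
    have h2 : Real.exp y * Real.exp (-y) = 1 := by rw [← Real.exp_add]; simp
    nlinarith [Real.exp_pos (-y)]
  have hSy : S * y ≤ 1 + y := by nlinarith
  have hyK : L = 2 * K * y := by rw [hy]; field_simp
  rw [inv_mul_le_iff₀ hK', mul_div_assoc', le_div_iff₀ (by linarith)]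
  have : S * L = 2 * K * (S * y) := by rw [hyK]; ring
  nlinarith

lemma schedule_sum_le {L : ℝ} {K : ℕ} (hL : 0 ≤ L) (hK : 0 < K) (hLK : L ≤ K) :
    ∑ l ∈ Finset.range (K + 1), (1 - schedule K l / schedule K (l + 1)) *
        Real.exp (-(L * (1 - schedule K (l + 1)))) ≤ 6 / (1 + L) := by
  have hK' : (0 : ℝ) < K := by exact_mod_cast hK
  have hfirst : (1 - schedule K 0 / schedule K (0 + 1)) *
      Real.exp (-(L * (1 - schedule K (0 + 1)))) ≤ 2 / (1 + L) := by
    rw [schedule_succ]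
    simp only [schedule, if_true, zero_div, sub_zero, one_mul, Nat.cast_zero, add_zero]
    rw [le_div_iff₀ (by linarith)]
    have h1 := Real.add_one_le_exp (L / 2)
    have h2 : Real.exp (L / 2) * Real.exp (-(L * (1 - 1 / 2))) = 1 := by
      rw [← Real.exp_add]
      norm_num
      ring
    nlinarith [Real.exp_pos (-(L * (1 - 1 / 2)))]
  have hrest : ∑ l ∈ Finset.range K, (1 - schedule K (l + 1) / schedule K (l + 1 + 1)) *
      Real.exp (-(L * (1 - schedule K (l + 1 + 1)))) ≤ 4 / (1 + L) := by
    refine le_trans ?_ (geom_exp_sum_le hL hK hLK)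
    rw [← Finset.sum_range_reflect, Finset.mul_sum]
    refine Finset.sum_le_sum fun j hj => ?_
    have hj := Finset.mem_range.1 hj
    have hcast : ((K - 1 - j : ℕ) : ℝ) = K - 1 - j := by
      rw [Nat.sub_sub, Nat.cast_sub (by omega)]
      push_cast
      ring
    have hexp : Real.exp (-(L * (1 - schedule K (K - 1 - j + 1 + 1))))
        = Real.exp (-(L / (2 * K))) ^ j := by
      rw [schedule_succ, ← Real.exp_nat_mul]
      push_cast
      rw [hcast]
      congr 1
      field_simp
      ring
    rw [hexp]
    refine mul_le_mul_of_nonneg_right ?_ (by positivity)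
    rw [one_sub_div (schedule_succ_pos _ _).ne', div_le_iff₀ (schedule_succ_pos _ _),
      inv_mul_eq_div, le_div_iff₀ hK', schedule_succ, schedule_succ]
    push_cast
    have : (0 : ℝ) ≤ ((K - 1 - j : ℕ) : ℝ) / K := by positivity
    field_simp at this ⊢
    nlinarith
  rw [Finset.sum_range_succ']
  calc _ ≤ 4 / (1 + L) + 2 / (1 + L) := add_le_add hrest hfirst
    _ = 6 / (1 + L) := by rw [← add_div]; norm_num

/-- Talagrand's influence inequality in spaces of martingale type 2. -/
theorem MartingaleTypeTwo.talagrand {F : Type*} [NormedAddCommGroup F] [NormedSpace ℝ F]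
    [CompleteSpace F] {M : ℝ} (hF : MartingaleTypeTwo F M) {n : ℕ} (f : Cube n → F) :
    cubeLp 2 (fun x => f x - cubeAvg f) ^ 2 ≤ 6 * M ^ 2 * ∑ i : Fin n,
      cubeLp 2 (dparC i f) ^ 2 /
        (1 + Real.log (cubeLp 2 (dparC i f) / cubeLp 1 (dparC i f))) := by
  set L : Fin n → ℝ := fun i => Real.log (cubeLp 2 (dparC i f) / cubeLp 1 (dparC i f)) with hL
  have hL0 : ∀ i, 0 ≤ L i := fun i => log_cubeLp_div_nonneg _
  obtain ⟨K, hK⟩ := exists_nat_gt (∑ i, L i)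
  have hK0 : 0 < K := by
    have := (Finset.sum_nonneg fun i _ => hL0 i).trans_lt hK
    exact_mod_cast this
  have hLK : ∀ i, L i ≤ K := fun i =>
    (Finset.single_le_sum (fun j _ => hL0 j) (Finset.mem_univ i)).trans hK.le
  have hmono := schedule_mono K
  have h := hF.cubeAvg_le f (K + 1) (schedule K) (by simp [schedule]) (schedule_last hK0) hmono
    (schedule_succ_pos K)
  rw [cubeLp_two_sq]
  refine h.trans ?_
  rw [mul_comm 6, mul_assoc]
  refine mul_le_mul_of_nonneg_left ?_ (sq_nonneg M)
  rw [Finset.sum_comm, Finset.mul_sum]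
  refine Finset.sum_le_sum fun i _ => ?_
  calc _ ≤ ∑ l ∈ Finset.range (K + 1), cubeLp 2 (dparC i f) ^ 2 *
        ((1 - schedule K l / schedule K (l + 1)) *
          Real.exp (-(L i * (1 - schedule K (l + 1))))) := by
        refine Finset.sum_le_sum fun l hl => ?_
        rw [mul_left_comm]
        refine mul_le_mul_of_nonneg_left (cube_sum_rpow_le _ (schedule_succ_pos K l).le ?_) ?_
        · exact schedule_last hK0 ▸ hmono (Nat.succ_le_of_lt (Finset.mem_range.1 hl))
        · exact sub_nonneg.2 ((div_le_one (schedule_succ_pos K l)).2 (hmono l.le_succ))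
    _ ≤ cubeLp 2 (dparC i f) ^ 2 * (6 / (1 + L i)) := by
        rw [← Finset.mul_sum]
        exact mul_le_mul_of_nonneg_left (schedule_sum_le (hL0 i) hK0 (hLK i)) (sq_nonneg _)
    _ = _ := by ring

/-- **Vector-valued influence inequality for spaces of martingale type 2** (Theorem 2).
If `E` is a complex Banach space of martingale type 2 with constant `M`, there is
`C = C(M) ∈ (0,∞)` such that every `f : 𝒞_n → E` satisfies
`‖f - E f‖₂² ≤ C ∑_i ‖∂_i f‖₂² / (1 + log(‖∂_i f‖₂/‖∂_i f‖₁))`.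
(When `∂_i f ≡ 0` the `i`-th summand below is automatically `0`.) -/
theorem talagrand_type_two_martingale
    (E : Type*) [NormedAddCommGroup E] [NormedSpace ℂ E] [CompleteSpace E]
    (M : ℝ) (hM : 0 < M)
    (hmart : ∀ (Ω : Type) (mΩ : MeasurableSpace Ω) (μ : Measure Ω),
      IsProbabilityMeasure μ → ∀ (ℱ : Filtration ℕ mΩ) (g : ℕ → Ω → E),
        Martingale g ℱ μ → ∀ N : ℕ,
          ∫ ω, ‖g N ω - g 0 ω‖ ^ 2 ∂μ
            ≤ M ^ 2 * ∑ i ∈ Finset.range N, ∫ ω, ‖g (i + 1) ω - g i ω‖ ^ 2 ∂μ) :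
    ∃ C : ℝ, 0 < C ∧ ∀ (n : ℕ) (f : Cube n → E),
      cubeLp 2 (fun x => f x - cubeAvg f) ^ 2
        ≤ C * ∑ i : Fin n,
            cubeLp 2 (dparC i f) ^ 2 /
              (1 + Real.log (cubeLp 2 (dparC i f) / cubeLp 1 (dparC i f))) := by
  exact ⟨6 * M ^ 2, by positivity, fun n f => MartingaleTypeTwo.talagrand hmart f⟩

end
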